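/- Let E be a row-finite graph, K a field, and H a finite hereditary subset of E^0. Set p_H = Σ_{v ∈ H} v ∈ L_K(E). Then p_H is an idempotent and p_H L_K(E) p_H is isomorphic as a K-algebra to the Leavitt path algebra L_K(E_H) of the restriction graph. -/

import Mathlib

/-- Generators of a Leavitt path algebra: vertices, edges, and ghost edges. -/
inductive LPAGen (V E : Type*) : Type _
  | vertex : V → LPAGen V E
  | edge : E → LPAGen V E
  | ghost : E → LPAGen V E

variable (K : Type*) [Field K] {V E : Type*} (s r : E → V)

open FreeAlgebra in
/-- The defining relations of the Leavitt path algebra of the graph `(V, E, s, r)` over `K`: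
the vertices are mutually orthogonal idempotents, edges and ghost edges are compatible with
sources and ranges, the Cuntz–Krieger relations (CK1) and (CK2) hold, and (when the vertex
set is finite) the sum of the vertices is the identity. -/
inductive LPARel : FreeAlgebra K (LPAGen V E) → FreeAlgebra K (LPAGen V E) → Prop
  | vertex_idem (v : V) :
      LPARel (ι K (LPAGen.vertex (E := E) v) * ι K (LPAGen.vertex v)) (ι K (LPAGen.vertex v))
  | vertex_orth (v w : V) : v ≠ w →
      LPARel (ι K (LPAGen.vertex (E := E) v) * ι K (LPAGen.vertex w)) 0
  | source_edge (e : E) :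
      LPARel (ι K (LPAGen.vertex (s e)) * ι K (LPAGen.edge (V := V) e)) (ι K (LPAGen.edge e))
  | edge_range (e : E) :
      LPARel (ι K (LPAGen.edge (V := V) e) * ι K (LPAGen.vertex (r e))) (ι K (LPAGen.edge e))
  | range_ghost (e : E) :
      LPARel (ι K (LPAGen.vertex (r e)) * ι K (LPAGen.ghost (V := V) e)) (ι K (LPAGen.ghost e))
  | ghost_source (e : E) :
      LPARel (ι K (LPAGen.ghost (V := V) e) * ι K (LPAGen.vertex (s e))) (ι K (LPAGen.ghost e))
  | ck1 (e : E) :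
      LPARel (ι K (LPAGen.ghost (V := V) e) * ι K (LPAGen.edge e)) (ι K (LPAGen.vertex (r e)))
  | ck1_orth (e f : E) : e ≠ f →
      LPARel (ι K (LPAGen.ghost (V := V) e) * ι K (LPAGen.edge f)) 0
  | ck2 (v : V) (S : Finset E) : (↑S = s ⁻¹' {v}) → S.Nonempty →
      LPARel (ι K (LPAGen.vertex (E := E) v))
        (∑ e ∈ S, ι K (LPAGen.edge (V := V) e) * ι K (LPAGen.ghost e))
  | unit (S : Finset V) : (↑S = (Set.univ : Set V)) →
      LPARel 1 (∑ v ∈ S, ι K (LPAGen.vertex (E := E) v))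

/-- The Leavitt path algebra of the graph `(V, E, s, r)` over the field `K`. -/
def LeavittPathAlgebra : Type _ := RingQuot (LPARel K s r)

noncomputable instance : Ring (LeavittPathAlgebra K s r) :=
  inferInstanceAs (Ring (RingQuot (LPARel K s r)))

noncomputable instance : Algebra K (LeavittPathAlgebra K s r) :=
  inferInstanceAs (Algebra K (RingQuot (LPARel K s r)))

/-- The image in the Leavitt path algebra of a vertex `v`. -/
noncomputable def lpaVertex (v : V) : LeavittPathAlgebra K s r :=
  RingQuot.mkAlgHom K (LPARel K s r) (FreeAlgebra.ι K (LPAGen.vertex v))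

/-- The image in the Leavitt path algebra of an edge `e`. -/
noncomputable def lpaEdge (e : E) : LeavittPathAlgebra K s r :=
  RingQuot.mkAlgHom K (LPARel K s r) (FreeAlgebra.ι K (LPAGen.edge e))

/-- A subset `H` of the vertices is hereditary if every edge with source in `H` has
range in `H`. -/
def GraphHereditary (H : Set V) : Prop := ∀ e : E, s e ∈ H → r e ∈ H

/-- A subset `X` of the vertices is saturated if every vertex which is not a sink and all of
whose emitted edges have range in `X` belongs to `X`. -/
def GraphSaturated (X : Set V) : Prop :=
  ∀ v : V, (∃ e, s e = v) → (∀ e, s e = v → r e ∈ X) → v ∈ X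

/-- The hereditary saturated closure of a set of vertices: the smallest hereditary and
saturated subset containing it. -/
def HSClosure (H : Set V) : Set V :=
  ⋂₀ {X : Set V | GraphHereditary s r X ∧ GraphSaturated s r X ∧ H ⊆ X}

/-- Elements of a ring satisfying the relations of the Leavitt path algebra of `(V, E, s, r)`,
except for the requirement that the vertices sum to `1`. -/
structure LeavittFamily (B : Type*) [Ring B] where
  vtx : V → B
  edge : E → B
  ghost : E → B
  vtx_idem (v : V) : vtx v * vtx v = vtx v
  vtx_orth (v w : V) : v ≠ w → vtx v * vtx w = 0
  source_edge (e : E) : vtx (s e) * edge e = edge e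
  edge_range (e : E) : edge e * vtx (r e) = edge e
  range_ghost (e : E) : vtx (r e) * ghost e = ghost e
  ghost_source (e : E) : ghost e * vtx (s e) = ghost e
  ck1 (e : E) : ghost e * edge e = vtx (r e)
  ck1_orth (e f : E) : e ≠ f → ghost e * edge f = 0
  ck2 (v : V) (S : Finset E) : (↑S = s ⁻¹' {v}) → S.Nonempty →
    vtx v = ∑ e ∈ S, edge e * ghost e

/-- The corner of a `K`-algebra at an idempotent is a `K`-algebra. -/
instance IsIdempotentElem.Corner.instAlgebra {K : Type*} [Field K] {B : Type*} [Ring B]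
    [Algebra K B] {u : B} (hu : IsIdempotentElem u) : Algebra K hu.Corner where
  smul k x := ⟨k • x.1, by
    have := (Subsemigroup.mem_corner_iff hu).1 x.2
    rw [Subsemigroup.mem_corner_iff hu, mul_smul_comm, smul_mul_assoc, this.1, this.2]
    exact ⟨rfl, rfl⟩⟩
  algebraMap :=
    { toFun k := ⟨k • u, by
        rw [Subsemigroup.mem_corner_iff hu, mul_smul_comm, smul_mul_assoc, hu.eq]
        exact ⟨rfl, rfl⟩⟩
      map_one' := Subtype.ext (one_smul K u)
      map_mul' a b := Subtype.ext (by
        change (a * b) • u = (a • u) * (b • u)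
        rw [smul_mul_smul_comm, hu.eq])
      map_zero' := Subtype.ext (zero_smul K u)
      map_add' a b := Subtype.ext (add_smul a b u) }
  commutes' k x := Subtype.ext (by
    have := (Subsemigroup.mem_corner_iff hu).1 x.2
    change k • u * x.1 = x.1 * k • u
    rw [smul_mul_assoc, mul_smul_comm, this.1, this.2])
  smul_def' k x := Subtype.ext (by
    have := (Subsemigroup.mem_corner_iff hu).1 x.2
    change k • x.1 = k • u * x.1
    rw [smul_mul_assoc, this.1])

/-- The inclusion of the corner of a `K`-algebra at an idempotent. -/
def IsIdempotentElem.Corner.subtype (K : Type*) [Field K] {B : Type*} [Ring B]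
    [Algebra K B] {u : B} (hu : IsIdempotentElem u) : hu.Corner →ₙₐ[K] B where
  toFun x := x.1
  map_smul' _ _ := rfl
  map_zero' := rfl
  map_add' _ _ := rfl
  map_mul' _ _ := rfl

/-- The image in the Leavitt path algebra of a ghost edge `e`. -/
noncomputable def lpaGhost (e : E) : LeavittPathAlgebra K s r :=
  RingQuot.mkAlgHom K (LPARel K s r) (FreeAlgebra.ι K (LPAGen.ghost e))

/-- The generators of the Leavitt path algebra. -/
noncomputable def lpaFamily : LeavittFamily s r (LeavittPathAlgebra K s r) where
  vtx := lpaVertex K s r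
  edge := lpaEdge K s r
  ghost := lpaGhost K s r
  vtx_idem v := (map_mul _ _ _).symm.trans
    (RingQuot.mkAlgHom_rel K (LPARel.vertex_idem (s := s) (r := r) v))
  vtx_orth v w h := (map_mul _ _ _).symm.trans
    ((RingQuot.mkAlgHom_rel K (LPARel.vertex_orth (s := s) (r := r) v w h)).trans (map_zero _))
  source_edge e := (map_mul _ _ _).symm.trans
    (RingQuot.mkAlgHom_rel K (LPARel.source_edge (s := s) (r := r) e))
  edge_range e := (map_mul _ _ _).symm.trans
    (RingQuot.mkAlgHom_rel K (LPARel.edge_range (s := s) (r := r) e))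
  range_ghost e := (map_mul _ _ _).symm.trans
    (RingQuot.mkAlgHom_rel K (LPARel.range_ghost (s := s) (r := r) e))
  ghost_source e := (map_mul _ _ _).symm.trans
    (RingQuot.mkAlgHom_rel K (LPARel.ghost_source (s := s) (r := r) e))
  ck1 e := (map_mul _ _ _).symm.trans
    (RingQuot.mkAlgHom_rel K (LPARel.ck1 (s := s) (r := r) e))
  ck1_orth e f h := (map_mul _ _ _).symm.trans
    ((RingQuot.mkAlgHom_rel K (LPARel.ck1_orth (s := s) (r := r) e f h)).trans (map_zero _))
  ck2 v S hS hne := by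
    refine (RingQuot.mkAlgHom_rel K (LPARel.ck2 (s := s) (r := r) v S hS hne)).trans ?_
    refine (map_sum _ _ _).trans (Finset.sum_congr rfl fun e _ => ?_)
    exact map_mul _ _ _

theorem lpa_one_eq_sum (S : Finset V) (hS : (↑S : Set V) = Set.univ) :
    (1 : LeavittPathAlgebra K s r) = ∑ v ∈ S, lpaVertex K s r v :=
  (map_one (RingQuot.mkAlgHom K (LPARel K s r))).symm.trans
    ((RingQuot.mkAlgHom_rel K (LPARel.unit (s := s) (r := r) S hS)).trans (map_sum _ _ _))

theorem lpa_induction {motive : LeavittPathAlgebra K s r → Prop}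
    (one : motive 1) (smul : ∀ (k : K) a, motive a → motive (k • a))
    (vtx : ∀ v, motive (lpaVertex K s r v)) (edge : ∀ e, motive (lpaEdge K s r e))
    (ghost : ∀ e, motive (lpaGhost K s r e))
    (mul : ∀ a b, motive a → motive b → motive (a * b))
    (add : ∀ a b, motive a → motive b → motive (a + b)) (a : LeavittPathAlgebra K s r) :
    motive a := by
  obtain ⟨x, rfl⟩ := RingQuot.mkAlgHom_surjective K (LPARel K s r) a
  induction x using FreeAlgebra.induction with
  | grade0 k =>
    rw [AlgHom.commutes]
    have := smul k 1 one
    rwa [← Algebra.algebraMap_eq_smul_one] at this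
  | grade1 x =>
    cases x with
    | vertex v => exact vtx v
    | edge e => exact edge e
    | ghost e => exact ghost e
  | mul a b ha hb => rw [map_mul]; exact mul _ _ ha hb
  | add a b ha hb => rw [map_add]; exact add _ _ ha hb

namespace LeavittFamily

variable {K s r} {B : Type*} [Ring B] [Algebra K B] (F : LeavittFamily s r B)

/-- The non-unital universal property of the Leavitt path algebra: a family satisfying its
relations relative to an idempotent `u` induces a homomorphism carrying `1` to `u`. -/
theorem exists_nonUnitalAlgHom {u : B} (hu : IsIdempotentElem u)
    (hl : ∀ v, u * F.vtx v = F.vtx v) (hr : ∀ v, F.vtx v * u = F.vtx v)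
    (hone : ∀ S : Finset V, (↑S : Set V) = Set.univ → u = ∑ v ∈ S, F.vtx v) :
    ∃ f : LeavittPathAlgebra K s r →ₙₐ[K] B, f 1 = u ∧
      (∀ v, f (lpaVertex K s r v) = F.vtx v) ∧ (∀ e, f (lpaEdge K s r e) = F.edge e) ∧
      ∀ e, f (lpaGhost K s r e) = F.ghost e := by
  have mv (v) : F.vtx v ∈ Subsemigroup.corner u :=
    (Subsemigroup.mem_corner_iff hu).2 ⟨hl v, hr v⟩
  have me (e) : F.edge e ∈ Subsemigroup.corner u := by
    refine (Subsemigroup.mem_corner_iff hu).2 ⟨?_, ?_⟩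
    · rw [← F.source_edge, ← mul_assoc, hl]
    · rw [← F.edge_range, mul_assoc, hr]
  have mg (e) : F.ghost e ∈ Subsemigroup.corner u := by
    refine (Subsemigroup.mem_corner_iff hu).2 ⟨?_, ?_⟩
    · rw [← F.range_ghost, ← mul_assoc, hl]
    · rw [← F.ghost_source, mul_assoc, hr]
  let g : LPAGen V E → hu.Corner := fun x => match x with
    | .vertex v => ⟨F.vtx v, mv v⟩
    | .edge e => ⟨F.edge e, me e⟩
    | .ghost e => ⟨F.ghost e, mg e⟩
  let φ : FreeAlgebra K (LPAGen V E) →ₐ[K] hu.Corner := FreeAlgebra.lift K g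
  have hφ : ∀ x, φ (FreeAlgebra.ι K x) = g x := fun x => FreeAlgebra.lift_ι_apply g x
  let ψ := IsIdempotentElem.Corner.subtype K hu
  have hψ : Function.Injective ψ := Subtype.val_injective
  have hgv (v) : ψ (g (.vertex v)) = F.vtx v := rfl
  have hge (e) : ψ (g (.edge e)) = F.edge e := rfl
  have hgg (e) : ψ (g (.ghost e)) = F.ghost e := rfl
  have h1 : ψ 1 = u := rfl
  have hrel : ∀ ⦃x y⦄, LPARel K s r x y → φ x = φ y := by
    intro x y hxy
    apply hψ
    cases hxy with
    | vertex_idem v => simp only [map_mul, hφ, hgv, F.vtx_idem]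
    | vertex_orth v w h => simp only [map_mul, map_zero, hφ, hgv, F.vtx_orth v w h]
    | source_edge e => simp only [map_mul, hφ, hgv, hge, F.source_edge]
    | edge_range e => simp only [map_mul, hφ, hgv, hge, F.edge_range]
    | range_ghost e => simp only [map_mul, hφ, hgv, hgg, F.range_ghost]
    | ghost_source e => simp only [map_mul, hφ, hgv, hgg, F.ghost_source]
    | ck1 e => simp only [map_mul, hφ, hgv, hge, hgg, F.ck1]
    | ck1_orth e f h => simp only [map_mul, map_zero, hφ, hge, hgg, F.ck1_orth e f h]
    | ck2 v S hS hne => simp only [map_sum, map_mul, hφ, hgv, hge, hgg, F.ck2 v S hS hne]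
    | unit S hS => simp only [map_sum, map_one, hφ, hgv, h1, hone S hS]
  let Φ : LeavittPathAlgebra K s r →ₐ[K] hu.Corner := RingQuot.liftAlgHom K ⟨φ, hrel⟩
  have hΦ (x) : Φ (RingQuot.mkAlgHom K (LPARel K s r) (FreeAlgebra.ι K x)) = g x :=
    (RingQuot.liftAlgHom_mkAlgHom_apply K φ hrel _).trans (hφ x)
  refine ⟨ψ.comp (Φ : LeavittPathAlgebra K s r →ₙₐ[K] hu.Corner), ?_, fun v => ?_, fun e => ?_,
    fun e => ?_⟩
  · exact congrArg ψ (map_one Φ)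
  · exact congrArg ψ (hΦ _)
  · exact congrArg ψ (hΦ _)
  · exact congrArg ψ (hΦ _)

theorem sum_vtx_mul_vtx [DecidableEq V] (S : Finset V) (v : V) :
    (∑ w ∈ S, F.vtx w) * F.vtx v = if v ∈ S then F.vtx v else 0 := by
  rw [Finset.sum_mul, ← Finset.sum_ite_eq' S v F.vtx]
  refine Finset.sum_congr rfl fun w _ => ?_
  split_ifs with h
  · rw [h, F.vtx_idem]
  · exact F.vtx_orth _ _ h

theorem vtx_mul_sum_vtx [DecidableEq V] (S : Finset V) (v : V) :
    F.vtx v * (∑ w ∈ S, F.vtx w) = if v ∈ S then F.vtx v else 0 := by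
  rw [Finset.mul_sum, ← Finset.sum_ite_eq' S v F.vtx]
  refine Finset.sum_congr rfl fun w _ => ?_
  split_ifs with h
  · rw [h, F.vtx_idem]
  · exact F.vtx_orth _ _ (Ne.symm h)

theorem isIdempotentElem_sum_vtx (S : Finset V) : IsIdempotentElem (∑ v ∈ S, F.vtx v) := by
  classical
  rw [IsIdempotentElem, Finset.mul_sum]
  exact Finset.sum_congr rfl fun v hv => by rw [F.sum_vtx_mul_vtx, if_pos hv]

theorem exists_nonUnitalAlgHom_of_family :
    ∃ f : LeavittPathAlgebra K s r →ₙₐ[K] B,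
      (∀ v, f (lpaVertex K s r v) = F.vtx v) ∧ (∀ e, f (lpaEdge K s r e) = F.edge e) ∧
      ∀ e, f (lpaGhost K s r e) = F.ghost e := by
  classical
  by_cases hV : Finite V
  · have := Fintype.ofFinite V
    obtain ⟨f, -, hf⟩ := F.exists_nonUnitalAlgHom (K := K)
      (F.isIdempotentElem_sum_vtx Finset.univ) (fun v => by simp [sum_vtx_mul_vtx])
      (fun v => by simp [vtx_mul_sum_vtx]) (fun S hS => by rw [Finset.coe_eq_univ.1 hS])
    exact ⟨f, hf⟩
  · obtain ⟨f, -, hf⟩ := F.exists_nonUnitalAlgHom (K := K) IsIdempotentElem.one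
      (fun v => one_mul _) (fun v => mul_one _)
      (fun S hS => (hV (Set.finite_univ_iff.1 (hS ▸ S.finite_toSet))).elim)
    exact ⟨f, hf⟩

end LeavittFamily

section Restriction

variable {V E : Type*} {s r : E → V} {H : Set V} (hH : GraphHereditary s r H)

/-- The source map of the restriction of a graph to a set `H` of vertices. -/
abbrev restrictSource (s : E → V) (H : Set V) : {e : E // s e ∈ H} → H :=
  fun e => ⟨s e.1, e.2⟩

/-- The range map of the restriction of a graph to a hereditary set `H` of vertices. -/
abbrev restrictRange (hH : GraphHereditary s r H) : {e : E // s e ∈ H} → H :=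
  fun e => ⟨r e.1, hH e.1 e.2⟩

namespace LeavittFamily

variable {B : Type*} [Ring B]

/-- The restriction of a family to a hereditary set of vertices. -/
def restrict (F : LeavittFamily s r B) :
    LeavittFamily (restrictSource s H) (restrictRange hH) B where
  vtx v := F.vtx v
  edge e := F.edge e
  ghost e := F.ghost e
  vtx_idem v := F.vtx_idem v
  vtx_orth v w h := F.vtx_orth v w fun h' => h (Subtype.ext h')
  source_edge e := F.source_edge e
  edge_range e := F.edge_range e
  range_ghost e := F.range_ghost e
  ghost_source e := F.ghost_source e
  ck1 e := F.ck1 e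
  ck1_orth e f h := F.ck1_orth e f fun h' => h (Subtype.ext h')
  ck2 v S hS hne := by
    rw [F.ck2 v (S.map (Function.Embedding.subtype _)) _ (hne.map), Finset.sum_map]
    · rfl
    ext e
    have (he : s e ∈ H) : (⟨e, he⟩ : {e : E // s e ∈ H}) ∈ S ↔ s e = v := by
      rw [← Finset.mem_coe, hS]
      simp [Subtype.ext_iff]
    simp only [Finset.coe_map, Function.Embedding.subtype_apply, Set.mem_image, Finset.mem_coe,
      Subtype.exists, exists_and_right, exists_eq_right, Set.mem_preimage, Set.mem_singleton_iff]
    exact ⟨fun ⟨he, h⟩ => (this he).1 h, fun h => ⟨h ▸ v.2, (this _).2 h⟩⟩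

variable {hH} (F : LeavittFamily (restrictSource s H) (restrictRange hH) B)

open Classical in
/-- The idempotent of `B` by which the vertex `v` acts on the component of a list of edges `l`:
it is nonzero only if `l` is a path from `v` to `H` meeting `H` only at its end, in which case
it is the vertex at the end of `l`. -/
noncomputable def pathVertex (v : V) : List E → B
  | [] => if h : v ∈ H then F.vtx ⟨v, h⟩ else 0
  | e :: l => if s e = v ∧ v ∉ H then pathVertex (r e) l else 0

theorem pathVertex_idem (v : V) (l : List E) :
    F.pathVertex v l * F.pathVertex v l = F.pathVertex v l := by
  induction l generalizing v with
  | nil => simp only [pathVertex]; split_ifs <;> simp [F.vtx_idem]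
  | cons e l ih => simp only [pathVertex]; split_ifs <;> simp [ih]

theorem pathVertex_orth (v w : V) (h : v ≠ w) (l : List E) :
    F.pathVertex v l * F.pathVertex w l = 0 := by
  cases l with
  | nil =>
    simp only [pathVertex]
    split_ifs
    · exact F.vtx_orth _ _ (by simpa using h)
    all_goals simp
  | cons e l =>
    simp only [pathVertex]
    split_ifs with h1 h2
    · exact (h (h1.1.symm.trans h2.1)).elim
    all_goals simp

variable (K : Type*) [Field K] [Algebra K B]

/-- The action of a vertex on the functions from lists of edges to `B`. -/
noncomputable def vertexOp (v : V) : Module.End K (List E → B) where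
  toFun g l := F.pathVertex v l * g l
  map_add' g g' := by ext l; simp [mul_add]
  map_smul' k g := by ext l; simp

open Classical in
/-- The action of an edge on the functions from lists of edges to `B`. -/
noncomputable def edgeOp (e : E) : Module.End K (List E → B) where
  toFun g l := match l with
    | [] => if h : s e ∈ H then F.edge ⟨e, h⟩ * g [] else 0
    | e' :: l => if e' = e ∧ s e ∉ H then F.pathVertex (r e) l * g l else 0
  map_add' g g' := by
    ext l
    rcases l with _ | ⟨e', l⟩ <;> simp only [Pi.add_apply] <;> split_ifs <;> simp [mul_add]
  map_smul' k g := by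
    ext l
    rcases l with _ | ⟨e', l⟩ <;> simp only [Pi.smul_apply] <;> split_ifs <;> simp

open Classical in
/-- The action of a ghost edge on the functions from lists of edges to `B`. -/
noncomputable def ghostOp (e : E) : Module.End K (List E → B) where
  toFun g l := if h : s e ∈ H then (match l with
    | [] => F.ghost ⟨e, h⟩ * g []
    | _ :: _ => 0) else F.pathVertex (r e) l * g (e :: l)
  map_add' g g' := by
    ext l
    rcases l with _ | ⟨e', l⟩ <;> simp only [Pi.add_apply] <;> split_ifs <;> simp [mul_add]
  map_smul' k g := by
    ext l
    rcases l with _ | ⟨e', l⟩ <;> simp only [Pi.smul_apply] <;> split_ifs <;> simp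

theorem vertexOp_apply (v : V) (g : List E → B) (l : List E) :
    F.vertexOp K v g l = F.pathVertex v l * g l := rfl

theorem edgeOp_apply_nil {e : E} (h : s e ∈ H) (g : List E → B) :
    F.edgeOp K e g [] = F.edge ⟨e, h⟩ * g [] := dif_pos h

theorem edgeOp_apply_nil_of_notMem {e : E} (h : s e ∉ H) (g : List E → B) :
    F.edgeOp K e g [] = 0 := dif_neg h

theorem edgeOp_apply_cons_of_mem {e : E} (h : s e ∈ H) (g : List E → B) (e' : E) (l : List E) :
    F.edgeOp K e g (e' :: l) = 0 := if_neg fun h' => h'.2 h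

theorem edgeOp_apply_cons_self {e : E} (h : s e ∉ H) (g : List E → B) (l : List E) :
    F.edgeOp K e g (e :: l) = F.pathVertex (r e) l * g l := if_pos ⟨rfl, h⟩

theorem edgeOp_apply_cons_of_ne {e e' : E} (h : e' ≠ e) (g : List E → B) (l : List E) :
    F.edgeOp K e g (e' :: l) = 0 := if_neg fun h' => h h'.1

theorem ghostOp_apply_nil {e : E} (h : s e ∈ H) (g : List E → B) :
    F.ghostOp K e g [] = F.ghost ⟨e, h⟩ * g [] := dif_pos h

theorem ghostOp_apply_cons {e : E} (h : s e ∈ H) (g : List E → B) (e' : E) (l : List E) :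
    F.ghostOp K e g (e' :: l) = 0 := dif_pos h

theorem ghostOp_apply_of_notMem {e : E} (h : s e ∉ H) (g : List E → B) (l : List E) :
    F.ghostOp K e g l = F.pathVertex (r e) l * g (e :: l) := dif_neg h

theorem pathVertex_nil {v : V} (h : v ∈ H) : F.pathVertex v [] = F.vtx ⟨v, h⟩ := dif_pos h

theorem pathVertex_nil_of_notMem {v : V} (h : v ∉ H) : F.pathVertex v [] = 0 := dif_neg h

theorem pathVertex_cons_of_mem {v : V} (h : v ∈ H) (e : E) (l : List E) :
    F.pathVertex v (e :: l) = 0 := if_neg fun h' => h'.2 h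

theorem pathVertex_cons {e : E} (h : s e ∉ H) (l : List E) :
    F.pathVertex (s e) (e :: l) = F.pathVertex (r e) l := if_pos ⟨rfl, h⟩

theorem pathVertex_cons_of_ne {v : V} {e : E} (h : s e ≠ v) (l : List E) :
    F.pathVertex v (e :: l) = 0 := if_neg fun h' => h h'.1

/-- The family of operators on the functions from lists of edges to `B` induced by a family
of elements of `B` for the restriction graph. -/
noncomputable def induced : LeavittFamily s r (Module.End K (List E → B)) where
  vtx := F.vertexOp K
  edge := F.edgeOp K
  ghost := F.ghostOp K
  vtx_idem v := by
    ext g l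
    simp only [Module.End.mul_apply, vertexOp_apply, ← mul_assoc, pathVertex_idem]
  vtx_orth v w h := by
    ext g l
    simp [Module.End.mul_apply, vertexOp_apply, ← mul_assoc, F.pathVertex_orth v w h]
  source_edge e := by
    ext g l
    simp only [Module.End.mul_apply, vertexOp_apply]
    by_cases h : s e ∈ H
    · rcases l with _ | ⟨e', l⟩
      · rw [F.edgeOp_apply_nil K h, F.pathVertex_nil h, ← mul_assoc]
        exact congrArg (· * g []) (F.source_edge ⟨e, h⟩)
      · rw [F.edgeOp_apply_cons_of_mem K h, mul_zero]
    · rcases l with _ | ⟨e', l⟩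
      · rw [F.edgeOp_apply_nil_of_notMem K h, mul_zero]
      · by_cases he : e' = e
        · subst he
          rw [F.edgeOp_apply_cons_self K h, F.pathVertex_cons h, ← mul_assoc, pathVertex_idem]
        · rw [F.edgeOp_apply_cons_of_ne K he, mul_zero]
  edge_range e := by
    ext g l
    simp only [Module.End.mul_apply]
    by_cases h : s e ∈ H
    · rcases l with _ | ⟨e', l⟩
      · rw [F.edgeOp_apply_nil K h, F.edgeOp_apply_nil K h, vertexOp_apply,
          F.pathVertex_nil (hH e h), ← mul_assoc]
        exact congrArg (· * g []) (F.edge_range ⟨e, h⟩)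
      · rw [F.edgeOp_apply_cons_of_mem K h, F.edgeOp_apply_cons_of_mem K h]
    · rcases l with _ | ⟨e', l⟩
      · rw [F.edgeOp_apply_nil_of_notMem K h, F.edgeOp_apply_nil_of_notMem K h]
      · by_cases he : e' = e
        · subst he
          rw [F.edgeOp_apply_cons_self K h, F.edgeOp_apply_cons_self K h, vertexOp_apply,
            ← mul_assoc, pathVertex_idem]
        · rw [F.edgeOp_apply_cons_of_ne K he, F.edgeOp_apply_cons_of_ne K he]
  range_ghost e := by
    ext g l
    simp only [Module.End.mul_apply, vertexOp_apply]
    by_cases h : s e ∈ H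
    · rcases l with _ | ⟨e', l⟩
      · rw [F.ghostOp_apply_nil K h, F.pathVertex_nil (hH e h), ← mul_assoc]
        exact congrArg (· * g []) (F.range_ghost ⟨e, h⟩)
      · rw [F.ghostOp_apply_cons K h, mul_zero]
    · rw [F.ghostOp_apply_of_notMem K h, ← mul_assoc, pathVertex_idem]
  ghost_source e := by
    ext g l
    simp only [Module.End.mul_apply]
    by_cases h : s e ∈ H
    · rcases l with _ | ⟨e', l⟩
      · rw [F.ghostOp_apply_nil K h, F.ghostOp_apply_nil K h, vertexOp_apply,
          F.pathVertex_nil h, ← mul_assoc]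
        exact congrArg (· * g []) (F.ghost_source ⟨e, h⟩)
      · rw [F.ghostOp_apply_cons K h, F.ghostOp_apply_cons K h]
    · rw [F.ghostOp_apply_of_notMem K h, F.ghostOp_apply_of_notMem K h, vertexOp_apply,
        F.pathVertex_cons h, ← mul_assoc, pathVertex_idem]
  ck1 e := by
    ext g l
    simp only [Module.End.mul_apply, vertexOp_apply]
    by_cases h : s e ∈ H
    · rcases l with _ | ⟨e', l⟩
      · rw [F.ghostOp_apply_nil K h, F.edgeOp_apply_nil K h, F.pathVertex_nil (hH e h),
          ← mul_assoc]
        exact congrArg (· * g []) (F.ck1 ⟨e, h⟩)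
      · rw [F.ghostOp_apply_cons K h, F.pathVertex_cons_of_mem (hH e h), zero_mul]
    · rw [F.ghostOp_apply_of_notMem K h, F.edgeOp_apply_cons_self K h, ← mul_assoc,
        pathVertex_idem]
  ck1_orth e f hef := by
    ext g l
    simp only [Module.End.mul_apply, LinearMap.zero_apply, Pi.zero_apply]
    by_cases h : s e ∈ H
    · rcases l with _ | ⟨e', l⟩
      · rw [F.ghostOp_apply_nil K h]
        by_cases h' : s f ∈ H
        · rw [F.edgeOp_apply_nil K h', ← mul_assoc,
            F.ck1_orth ⟨e, h⟩ ⟨f, h'⟩ (by simpa using hef), zero_mul]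
        · rw [F.edgeOp_apply_nil_of_notMem K h', mul_zero]
      · rw [F.ghostOp_apply_cons K h]
    · rw [F.ghostOp_apply_of_notMem K h, F.edgeOp_apply_cons_of_ne K hef, mul_zero]
  ck2 v S hS hne := by
    classical
    have hmem (e) : e ∈ S ↔ s e = v := by rw [← Finset.mem_coe, hS]; simp
    ext g l
    simp only [LinearMap.sum_apply, Finset.sum_apply, Module.End.mul_apply, vertexOp_apply]
    by_cases h : v ∈ H
    · have hs : ∀ e ∈ S, s e ∈ H := fun e he => (hmem e).1 he ▸ h
      rcases l with _ | ⟨e', l⟩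
      · have key := F.ck2 ⟨v, h⟩ (S.subtype (s · ∈ H)) (by
          ext e
          simp [hmem, Subtype.ext_iff]) (by
          obtain ⟨e, he⟩ := hne
          exact ⟨⟨e, hs e he⟩, by simpa using he⟩)
        rw [F.pathVertex_nil h, key, Finset.sum_mul]
        refine Eq.trans ?_ (Finset.sum_subtype_of_mem (p := (s · ∈ H))
          (fun e => F.edgeOp K e (F.ghostOp K e g) []) hs)
        refine Finset.sum_congr rfl fun e _ => ?_
        rw [F.edgeOp_apply_nil K e.2, F.ghostOp_apply_nil K e.2, mul_assoc]
      · rw [F.pathVertex_cons_of_mem h, zero_mul]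
        exact (Finset.sum_eq_zero fun e he => F.edgeOp_apply_cons_of_mem K (hs e he) _ _ _).symm
    · have hs : ∀ e ∈ S, s e ∉ H := fun e he => (hmem e).1 he ▸ h
      rcases l with _ | ⟨e', l⟩
      · rw [F.pathVertex_nil_of_notMem h, zero_mul]
        exact (Finset.sum_eq_zero fun e he => F.edgeOp_apply_nil_of_notMem K (hs e he) _).symm
      · by_cases he : s e' = v
        · subst he
          rw [Finset.sum_eq_single_of_mem e' ((hmem _).2 rfl) fun f _ hf =>
            F.edgeOp_apply_cons_of_ne K (Ne.symm hf) _ _, F.edgeOp_apply_cons_self K h,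
            F.ghostOp_apply_of_notMem K h, F.pathVertex_cons h, ← mul_assoc, pathVertex_idem]
        · rw [F.pathVertex_cons_of_ne he, zero_mul]
          refine (Finset.sum_eq_zero fun f hf => F.edgeOp_apply_cons_of_ne K ?_ _ _).symm
          rintro rfl
          exact he ((hmem _).1 hf)

end LeavittFamily

variable {hH} {K : Type*} [Field K]
  {f : LeavittPathAlgebra K (restrictSource s H) (restrictRange hH) →ₙₐ[K]
    LeavittPathAlgebra K s r}

/-- A homomorphism from the Leavitt path algebra of the restriction graph which maps generators
to generators is injective. -/
theorem lpa_restrict_injective (hfin : H.Finite)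
    (h1 : f 1 = ∑ v ∈ hfin.toFinset, lpaVertex K s r v)
    (hv : ∀ v, f (lpaVertex K _ _ v) = lpaVertex K s r v)
    (he : ∀ e, f (lpaEdge K _ _ e) = lpaEdge K s r e)
    (hg : ∀ e, f (lpaGhost K _ _ e) = lpaGhost K s r e) : Function.Injective f := by
  let F := lpaFamily K (restrictSource s H) (restrictRange hH)
  obtain ⟨ρ, ρv, ρe, ρg⟩ := (F.induced K).exists_nonUnitalAlgHom_of_family (K := K)
  have key (a) : ∀ g, ρ (f a) g [] = a * g [] := by
    induction a using lpa_induction with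
    | one =>
      intro g
      have := hfin.fintype
      rw [h1, map_sum, LinearMap.sum_apply, Finset.sum_apply,
        lpa_one_eq_sum K _ _ Finset.univ Finset.coe_univ, Finset.sum_mul]
      refine (Finset.sum_subtype _ (fun v => hfin.mem_toFinset)
        (fun v => ρ (lpaVertex K s r v) g [])).trans (Finset.sum_congr rfl fun v _ => ?_)
      rw [ρv]
      exact (F.vertexOp_apply K v g []).trans (by rw [F.pathVertex_nil v.2]; rfl)
    | smul k a ih => intro g; rw [map_smul, map_smul, smul_mul_assoc, ← ih]; rfl
    | vtx v =>
      intro g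
      rw [hv, ρv]
      exact (F.vertexOp_apply K v g []).trans (by rw [F.pathVertex_nil v.2]; rfl)
    | edge e => intro g; rw [he, ρe]; exact F.edgeOp_apply_nil K e.2 g
    | ghost e => intro g; rw [hg, ρg]; exact F.ghostOp_apply_nil K e.2 g
    | mul a b iha ihb => intro g; rw [map_mul, map_mul, Module.End.mul_apply, iha, ihb, mul_assoc]
    | add a b iha ihb => intro g; rw [map_add, map_add, add_mul, ← iha, ← ihb]; rfl
  intro a b hab
  have h := (key a fun _ => 1).symm.trans ((congrArg (ρ · (fun _ => 1) []) hab).trans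
    (key b fun _ => 1))
  rwa [mul_one, mul_one] at h

variable (f) in
/-- The sums of products of an element of the range of `f` on the left by a sequence of edges. -/
inductive PathMulRange : LeavittPathAlgebra K s r → Prop
  | range (c) : PathMulRange (f c)
  | edge_mul (e : E) (x) : PathMulRange x → PathMulRange (lpaEdge K s r e * x)
  | add (x y) : PathMulRange x → PathMulRange y → PathMulRange (x + y)

namespace PathMulRange

theorem zero : PathMulRange f 0 := by
  simpa using PathMulRange.range (f := f) 0

theorem smul (k : K) {x} (hx : PathMulRange f x) : PathMulRange f (k • x) := by
  induction hx with
  | range c => rw [← map_smul]; exact .range _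
  | edge_mul e x _ ih => rw [← mul_smul_comm]; exact .edge_mul e _ ih
  | add x y _ _ ihx ihy => rw [smul_add]; exact .add _ _ ihx ihy

variable {p : LeavittPathAlgebra K s r}

theorem vertex_mul (h1 : f 1 = p)
    (hp : ∀ v ∉ H, lpaVertex K s r v * p = 0)
    (hv : ∀ v, f (lpaVertex K _ _ v) = lpaVertex K s r v) (v : V) {x}
    (hx : PathMulRange f x) : PathMulRange f (lpaVertex K s r v * x) := by
  induction hx with
  | range c =>
    by_cases h : v ∈ H
    · rw [← hv ⟨v, h⟩, ← map_mul]
      exact .range _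
    · rw [← one_mul c, map_mul, h1, ← mul_assoc, hp v h, zero_mul]
      exact zero
  | edge_mul e x hx _ =>
    have hse : lpaVertex K s r (s e) * lpaEdge K s r e = lpaEdge K s r e :=
      (lpaFamily K s r).source_edge e
    rw [← mul_assoc]
    by_cases h : v = s e
    · rw [h, hse]
      exact .edge_mul e x hx
    · rw [← hse, ← mul_assoc, show lpaVertex K s r v * lpaVertex K s r (s e) = 0 from
        (lpaFamily K s r).vtx_orth v _ h, zero_mul, zero_mul]
      exact zero
  | add x y _ _ ihx ihy => rw [mul_add]; exact .add _ _ ihx ihy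

theorem ghost_mul (h1 : f 1 = p)
    (hp : ∀ v ∉ H, lpaVertex K s r v * p = 0)
    (hv : ∀ v, f (lpaVertex K _ _ v) = lpaVertex K s r v)
    (hg : ∀ e, f (lpaGhost K _ _ e) = lpaGhost K s r e) (e : E) {x}
    (hx : PathMulRange f x) : PathMulRange f (lpaGhost K s r e * x) := by
  induction hx with
  | range c =>
    by_cases h : s e ∈ H
    · rw [← hg ⟨e, h⟩, ← map_mul]
      exact .range _
    · have hgs : lpaGhost K s r e * lpaVertex K s r (s e) = lpaGhost K s r e :=
        (lpaFamily K s r).ghost_source e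
      rw [← one_mul c, map_mul, h1, ← hgs, ← mul_assoc, mul_assoc _ _ p, hp _ h, mul_zero,
        zero_mul]
      exact zero
  | edge_mul e' x hx _ =>
    rw [← mul_assoc]
    by_cases h : e = e'
    · rw [← h, show lpaGhost K s r e * lpaEdge K s r e = lpaVertex K s r (r e) from
        (lpaFamily K s r).ck1 e]
      exact vertex_mul h1 hp hv _ hx
    · rw [show lpaGhost K s r e * lpaEdge K s r e' = 0 from
        (lpaFamily K s r).ck1_orth e e' h, zero_mul]
      exact zero
  | add x y _ _ ihx ihy => rw [mul_add]; exact .add _ _ ihx ihy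

theorem mul_left (h1 : f 1 = p)
    (hp : ∀ v ∉ H, lpaVertex K s r v * p = 0)
    (hv : ∀ v, f (lpaVertex K _ _ v) = lpaVertex K s r v)
    (hg : ∀ e, f (lpaGhost K _ _ e) = lpaGhost K s r e) (a : LeavittPathAlgebra K s r) :
    ∀ x, PathMulRange f x → PathMulRange f (a * x) := by
  induction a using lpa_induction with
  | one => intro x hx; rwa [one_mul]
  | smul k a ih => intro x hx; rw [smul_mul_assoc]; exact (ih x hx).smul k
  | vtx v => exact fun x hx => vertex_mul h1 hp hv v hx
  | edge e => exact fun x hx => .edge_mul e x hx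
  | ghost e => exact fun x hx => ghost_mul h1 hp hv hg e hx
  | mul a b iha ihb => intro x hx; rw [mul_assoc]; exact iha _ (ihb _ hx)
  | add a b iha ihb => intro x hx; rw [add_mul]; exact .add _ _ (iha _ hx) (ihb _ hx)

theorem idem_mul_mem_range (h1 : f 1 = p)
    (hp : ∀ v ∉ H, p * lpaVertex K s r v = 0)
    (hpH : ∀ v ∈ H, lpaVertex K s r v * p = lpaVertex K s r v)
    (he : ∀ e, f (lpaEdge K _ _ e) = lpaEdge K s r e) {x} (hx : PathMulRange f x) :
    p * x ∈ Set.range f := by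
  induction hx with
  | range c => exact ⟨c, by rw [← h1, ← map_mul, one_mul]⟩
  | edge_mul e x _ ih =>
    by_cases h : s e ∈ H
    · obtain ⟨c, hc⟩ := ih
      have her : lpaEdge K s r e * lpaVertex K s r (r e) = lpaEdge K s r e :=
        (lpaFamily K s r).edge_range e
      have hep : lpaEdge K s r e * p = lpaEdge K s r e := by
        rw [← her, mul_assoc, hpH _ (hH e h)]
      refine ⟨1 * lpaEdge K _ _ ⟨e, h⟩ * c, ?_⟩
      rw [map_mul, map_mul, h1, he, hc, mul_assoc, ← mul_assoc _ p x, hep]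
    · have hse : lpaVertex K s r (s e) * lpaEdge K s r e = lpaEdge K s r e :=
        (lpaFamily K s r).source_edge e
      exact ⟨0, by rw [map_zero, ← hse, mul_assoc, ← mul_assoc, hp _ h, zero_mul]⟩
  | add x y _ _ ihx ihy =>
    obtain ⟨c, hc⟩ := ihx
    obtain ⟨d, hd⟩ := ihy
    exact ⟨c + d, by rw [map_add, hc, hd, mul_add]⟩

end PathMulRange

end Restriction

/-- Let `E` be a row-finite graph, `K` a field, and `H` a finite hereditary
subset of `E^0`.  Set `p_H = Σ_{v ∈ H} v ∈ L_K(E)`.  Then `p_H` is an idempotent and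
`p_H L_K(E) p_H` is isomorphic as a `K`-algebra to the Leavitt path algebra `L_K(E_H)` of the
restriction graph (an isomorphism being a `K`-linear multiplicative bijection onto
`p_H L_K(E) p_H`, carrying the identity of `L_K(E_H)` to `p_H`). -/
theorem stmt12 (hrow : ∀ v : V, (s ⁻¹' {v}).Finite) (H : Set V) (hfin : H.Finite)
    (hH : GraphHereditary s r H) :
    letI p : LeavittPathAlgebra K s r := ∑ v ∈ hfin.toFinset, lpaVertex K s r v
    p * p = p ∧
    ∃ f : LeavittPathAlgebra K (fun e : {e : E // s e ∈ H} => (⟨s e.1, e.2⟩ : H))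
        (fun e : {e : E // s e ∈ H} => (⟨r e.1, hH e.1 e.2⟩ : H)) →ₙₐ[K]
        LeavittPathAlgebra K s r,
      Function.Injective f ∧
      Set.range f = {x : LeavittPathAlgebra K s r | ∃ a, x = p * a * p} ∧
      f 1 = p := by
  classical
  have hmul (v : V) : lpaVertex K s r v * (∑ w ∈ hfin.toFinset, lpaVertex K s r w) =
      if v ∈ hfin.toFinset then lpaVertex K s r v else 0 :=
    (lpaFamily K s r).vtx_mul_sum_vtx _ v
  have mulh (v : V) : (∑ w ∈ hfin.toFinset, lpaVertex K s r w) * lpaVertex K s r v =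
      if v ∈ hfin.toFinset then lpaVertex K s r v else 0 :=
    (lpaFamily K s r).sum_vtx_mul_vtx _ v
  have hp : IsIdempotentElem (∑ v ∈ hfin.toFinset, lpaVertex K s r v) :=
    (lpaFamily K s r).isIdempotentElem_sum_vtx _
  refine ⟨hp, ?_⟩
  obtain ⟨f, h1, hv, he, hg⟩ := ((lpaFamily K s r).restrict hH).exists_nonUnitalAlgHom (K := K) hp
    (fun v => (mulh v).trans (if_pos (hfin.mem_toFinset.2 v.2)))
    (fun v => (hmul v).trans (if_pos (hfin.mem_toFinset.2 v.2)))
    (fun S hS => by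
      have := hfin.fintype
      rw [Finset.coe_eq_univ.1 hS]
      exact Finset.sum_subtype _ (fun v => hfin.mem_toFinset) _)
  refine ⟨f, lpa_restrict_injective hfin h1 hv he hg, ?_, h1⟩
  ext x
  constructor
  · rintro ⟨a, rfl⟩
    exact ⟨f a, by rw [← h1, ← map_mul, ← map_mul, one_mul, mul_one]⟩
  · rintro ⟨a, rfl⟩
    rw [mul_assoc]
    refine PathMulRange.idem_mul_mem_range h1
      (fun v h => (mulh v).trans (if_neg (mt hfin.mem_toFinset.1 h)))
      (fun v h => (hmul v).trans (if_pos (hfin.mem_toFinset.2 h))) he ?_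
    refine PathMulRange.mul_left h1
      (fun v h => (hmul v).trans (if_neg (mt hfin.mem_toFinset.1 h))) hv hg a _ ?_
    rw [← h1]
    exact .range 1
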